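/- The sequence A is nonuniform exponentially stable (i.e., it admits a negative admissible exponent) if and only if there exists an admissible exponent α of A for which the operator G_α is invertible on c00(α) (bijective with bounded inverse). -/

import Mathlib

open Filter Topology

variable {E : Type*} [NormedAddCommGroup E] [NormedSpace ℝ E] [CompleteSpace E]

/-- `evol A n m` is the evolution operator `A(m,n) = A_{m-1} ∘ ⋯ ∘ A_n`
(the identity if `m ≤ n`). -/
def evol (A : ℕ → E →L[ℝ] E) (n : ℕ) : ℕ → E →L[ℝ] E
  | 0 => 1
  | m + 1 => if n ≤ m then A m * evol A n m else 1

/-- `α` is an admissible exponent for `A`: there is a positive sequence `M` with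
`‖A(m,n)‖ ≤ M n * e^{α (m - n)}` for all `m ≥ n`. -/
def IsAdmissible (A : ℕ → E →L[ℝ] E) (α : ℝ) : Prop :=
  ∃ M : ℕ → ℝ, (∀ n, 0 < M n) ∧
    ∀ m n : ℕ, n ≤ m → ‖evol A n m‖ ≤ M n * Real.exp (α * ((m : ℝ) - (n : ℝ)))

/-- The norm `‖x‖_{n,α} = sup_{m ≥ n} e^{-α(m-n)} ‖A(m,n) x‖`. -/
noncomputable def nnorm (A : ℕ → E →L[ℝ] E) (α : ℝ) (n : ℕ) (x : E) : ℝ :=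
  ⨆ m : Set.Ici n, Real.exp (-α * (((m : ℕ) : ℝ) - (n : ℝ))) * ‖evol A n (m : ℕ) x‖

/-- Membership in `c00(α)`: `u 0 = 0` and `‖u n‖_{n,α} → 0`. -/
def MemC00 (A : ℕ → E →L[ℝ] E) (α : ℝ) (u : ℕ → E) : Prop :=
  u 0 = 0 ∧ Tendsto (fun n => nnorm A α n (u n)) atTop (𝓝 0)

/-- The norm `‖u‖_α = sup_n ‖u n‖_{n,α}` on `c00(α)`. -/
noncomputable def cnorm (A : ℕ → E →L[ℝ] E) (α : ℝ) (u : ℕ → E) : ℝ :=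
  ⨆ n, nnorm A α n (u n)

/-- The evolution map `T`: `(Tu)_0 = 0`, `(Tu)_{n+1} = A_n u_n`. -/
def Tmap (A : ℕ → E →L[ℝ] E) (u : ℕ → E) : ℕ → E
  | 0 => 0
  | m + 1 => A m (u m)

/-- `G = T - Id`. -/
def Gmap (A : ℕ → E →L[ℝ] E) (u : ℕ → E) : ℕ → E :=
  fun n => Tmap A u n - u n

/-- `G_α` is invertible on `c00(α)`: it maps `c00(α)` into itself, is bijective
on `c00(α)`, and has a bounded inverse. -/
def GInvertible (A : ℕ → E →L[ℝ] E) (α : ℝ) : Prop :=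
  (∀ u, MemC00 A α u → MemC00 A α (Gmap A u)) ∧
  (∀ v, MemC00 A α v → ∃ u, MemC00 A α u ∧ Gmap A u = v) ∧
  (∀ u : ℕ → E, MemC00 A α u → Gmap A u = 0 → u = 0) ∧
  ∃ c > 0, ∀ u, MemC00 A α u → cnorm A α u ≤ c * cnorm A α (Gmap A u)

set_option linter.unusedSectionVars false

theorem evol_self (A : ℕ → E →L[ℝ] E) (n : ℕ) : evol A n n = 1 := by
  cases n <;> simp [evol]

theorem evol_succ (A : ℕ → E →L[ℝ] E) {n m : ℕ} (h : n ≤ m) :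
    evol A n (m + 1) = A m * evol A n m := by
  simp [evol, h]

theorem evol_eq_evol_succ_mul (A : ℕ → E →L[ℝ] E) {n m : ℕ} (h : n + 1 ≤ m) :
    evol A n m = evol A (n + 1) m * A n := by
  induction m, h using Nat.le_induction with
  | base => rw [evol_succ A le_rfl, evol_self, evol_self, one_mul, mul_one]
  | succ m h ih => rw [evol_succ A (by omega), evol_succ A h, ih, mul_assoc]

theorem exp_mul_norm_evol_le {A : ℕ → E →L[ℝ] E} {α : ℝ} {M : ℕ → ℝ}
    (hM : ∀ m n : ℕ, n ≤ m → ‖evol A n m‖ ≤ M n * Real.exp (α * ((m : ℝ) - (n : ℝ))))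
    {n m : ℕ} (h : n ≤ m) (x : E) :
    Real.exp (-α * ((m : ℝ) - (n : ℝ))) * ‖evol A n m x‖ ≤ M n * ‖x‖ := by
  calc Real.exp (-α * ((m : ℝ) - (n : ℝ))) * ‖evol A n m x‖
      ≤ Real.exp (-α * ((m : ℝ) - (n : ℝ))) *
          ((M n * Real.exp (α * ((m : ℝ) - (n : ℝ)))) * ‖x‖) := by
        gcongr
        exact (evol A n m).le_of_opNorm_le (hM m n h) x
    _ = (Real.exp (-α * ((m : ℝ) - (n : ℝ))) * Real.exp (α * ((m : ℝ) - (n : ℝ)))) *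
          (M n * ‖x‖) := by ring
    _ = M n * ‖x‖ := by
        rw [← Real.exp_add, neg_mul, neg_add_cancel, Real.exp_zero, one_mul]

theorem nnorm_le {A : ℕ → E →L[ℝ] E} {α : ℝ} {n : ℕ} {x : E} {C : ℝ}
    (h : ∀ m, n ≤ m → Real.exp (-α * ((m : ℝ) - (n : ℝ))) * ‖evol A n m x‖ ≤ C) :
    nnorm A α n x ≤ C :=
  haveI : Nonempty (Set.Ici n) := ⟨⟨n, Set.mem_Ici.2 le_rfl⟩⟩
  ciSup_le fun m => h m m.2

theorem nnorm_le_mul_norm {A : ℕ → E →L[ℝ] E} {α : ℝ} {M : ℕ → ℝ}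
    (hM : ∀ m n : ℕ, n ≤ m → ‖evol A n m‖ ≤ M n * Real.exp (α * ((m : ℝ) - (n : ℝ))))
    (n : ℕ) (x : E) : nnorm A α n x ≤ M n * ‖x‖ :=
  nnorm_le fun _ h => exp_mul_norm_evol_le hM h x

theorem nnorm_nonneg (A : ℕ → E →L[ℝ] E) (α : ℝ) (n : ℕ) (x : E) : 0 ≤ nnorm A α n x :=
  Real.iSup_nonneg fun _ => by positivity

@[simp]
theorem nnorm_zero (A : ℕ → E →L[ℝ] E) (α : ℝ) (n : ℕ) : nnorm A α n 0 = 0 := by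
  simp [nnorm]

theorem nnorm_smul (A : ℕ → E →L[ℝ] E) (α : ℝ) (n : ℕ) (r : ℝ) (x : E) :
    nnorm A α n (r • x) = |r| * nnorm A α n x := by
  unfold nnorm
  rw [Real.mul_iSup_of_nonneg (abs_nonneg r)]
  congr 1
  ext m
  rw [map_smul, norm_smul, Real.norm_eq_abs]
  ring

theorem nnorm_neg (A : ℕ → E →L[ℝ] E) (α : ℝ) (n : ℕ) (x : E) :
    nnorm A α n (-x) = nnorm A α n x := by
  simp [nnorm]

namespace IsAdmissible

variable {A : ℕ → E →L[ℝ] E} {α : ℝ}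

theorem le_nnorm (hα : IsAdmissible A α) {n m : ℕ} (h : n ≤ m) (x : E) :
    Real.exp (-α * ((m : ℝ) - (n : ℝ))) * ‖evol A n m x‖ ≤ nnorm A α n x := by
  obtain ⟨M, -, hM⟩ := hα
  refine le_ciSup (f := fun m : Set.Ici n =>
    Real.exp (-α * (((m : ℕ) : ℝ) - (n : ℝ))) * ‖evol A n (m : ℕ) x‖) ?_ ⟨m, h⟩
  refine ⟨M n * ‖x‖, ?_⟩
  rintro _ ⟨k, rfl⟩
  exact exp_mul_norm_evol_le hM k.2 x

theorem norm_le_nnorm (hα : IsAdmissible A α) (n : ℕ) (x : E) : ‖x‖ ≤ nnorm A α n x := by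
  simpa [evol_self] using hα.le_nnorm (le_refl n) x

theorem nnorm_sub_le (hα : IsAdmissible A α) (n : ℕ) (x y : E) :
    nnorm A α n (x - y) ≤ nnorm A α n x + nnorm A α n y := by
  refine nnorm_le fun m h => ?_
  rw [map_sub]
  calc _ ≤ Real.exp (-α * ((m : ℝ) - (n : ℝ))) * (‖evol A n m x‖ + ‖evol A n m y‖) := by
        gcongr
        exact norm_sub_le _ _
    _ ≤ _ := by
        rw [mul_add]
        exact add_le_add (hα.le_nnorm h x) (hα.le_nnorm h y)

theorem nnorm_succ_apply_le (hα : IsAdmissible A α) (n : ℕ) (x : E) :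
    nnorm A α (n + 1) (A n x) ≤ Real.exp α * nnorm A α n x := by
  refine nnorm_le fun m h => ?_
  have h1 := hα.le_nnorm (n := n) (m := m) (by omega) x
  rw [evol_eq_evol_succ_mul A h, mul_apply_eq_comp] at h1
  calc Real.exp (-α * ((m : ℝ) - ((n + 1 : ℕ) : ℝ))) * ‖evol A (n + 1) m (A n x)‖
      = Real.exp α * (Real.exp (-α * ((m : ℝ) - (n : ℝ))) * ‖evol A (n + 1) m (A n x)‖) := by
        rw [← mul_assoc, ← Real.exp_add]
        congr 2
        push_cast
        ring
    _ ≤ _ := by gcongr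

end IsAdmissible

theorem MemC00.bddAbove {A : ℕ → E →L[ℝ] E} {α : ℝ} {u : ℕ → E} (hu : MemC00 A α u) :
    BddAbove (Set.range fun n => nnorm A α n (u n)) :=
  hu.2.bddAbove_range

theorem MemC00.nnorm_le_cnorm {A : ℕ → E →L[ℝ] E} {α : ℝ} {u : ℕ → E} (hu : MemC00 A α u)
    (n : ℕ) : nnorm A α n (u n) ≤ cnorm A α u :=
  le_ciSup hu.bddAbove n

theorem memC00_of_eventually_zero {A : ℕ → E →L[ℝ] E} {α : ℝ} {u : ℕ → E} (h0 : u 0 = 0) {N : ℕ}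
    (h : ∀ n, N ≤ n → u n = 0) : MemC00 A α u := by
  refine ⟨h0, tendsto_const_nhds.congr' ?_⟩
  filter_upwards [eventually_ge_atTop N] with n hn
  simp [h n hn]

theorem Gmap_injective (A : ℕ → E →L[ℝ] E) : Function.Injective (Gmap A) := by
  intro u w h
  have h0 := congrFun h 0
  ext n
  induction n with
  | zero => simpa [Gmap, Tmap] using h0
  | succ n ih =>
    have := congrFun h (n + 1)
    simpa [Gmap, Tmap, ih] using this

/-- A nonnegative sequence with `a (n + 1) ≤ q * a n + b (n + 1)`, `q < 1` and `b → 0`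
tends to zero. -/
theorem tendsto_zero_of_succ_le_mul_add {a b : ℕ → ℝ} {q : ℝ} (ha : ∀ n, 0 ≤ a n) (hq0 : 0 ≤ q)
    (hq1 : q < 1) (hb : Tendsto b atTop (𝓝 0)) (h : ∀ n, a (n + 1) ≤ q * a n + b (n + 1)) :
    Tendsto a atTop (𝓝 0) := by
  rw [Metric.tendsto_atTop]
  intro ε hε
  have hpos : 0 < (1 - q) * (ε / 2) := mul_pos (by linarith) (by linarith)
  obtain ⟨N, hN⟩ := eventually_atTop.1 (hb.eventually_lt_const hpos)
  have key : ∀ k, a (N + k) ≤ ε / 2 + q ^ k * a N := by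
    intro k
    induction k with
    | zero => simp; linarith
    | succ k ih =>
      have h1 := h (N + k)
      have h2 := hN (N + k + 1) (by omega)
      have h3 := mul_le_mul_of_nonneg_left ih hq0
      rw [← add_assoc, pow_succ]
      nlinarith
  have hlim : Tendsto (fun k => q ^ k * a N) atTop (𝓝 0) := by
    simpa using (tendsto_pow_atTop_nhds_zero_of_lt_one hq0 hq1).mul_const (a N)
  obtain ⟨K, hK⟩ := eventually_atTop.1 (hlim.eventually_lt_const (half_pos hε))
  refine ⟨N + K, fun n hn => ?_⟩
  obtain ⟨k, rfl⟩ := Nat.exists_eq_add_of_le (show N ≤ n by omega)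
  rw [Real.dist_eq, sub_zero, abs_of_nonneg (ha _)]
  have := key k
  have := hK k (by omega)
  linarith

theorem IsAdmissible.nnorm_Tmap_succ_le {A : ℕ → E →L[ℝ] E} {α : ℝ} (hα : IsAdmissible A α)
    (u : ℕ → E) (n : ℕ) :
    nnorm A α (n + 1) (Tmap A u (n + 1)) ≤ Real.exp α * nnorm A α n (u n) :=
  hα.nnorm_succ_apply_le n (u n)

theorem IsAdmissible.memC00_Gmap {A : ℕ → E →L[ℝ] E} {α : ℝ} (hα : IsAdmissible A α) {u : ℕ → E}
    (hu : MemC00 A α u) : MemC00 A α (Gmap A u) := by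
  refine ⟨by simp [Gmap, Tmap, hu.1], ?_⟩
  rw [← tendsto_add_atTop_iff_nat 1]
  have h1 : Tendsto (fun n => Real.exp α * nnorm A α n (u n) + nnorm A α (n + 1) (u (n + 1)))
      atTop (𝓝 0) := by
    simpa using (hu.2.const_mul (Real.exp α)).add ((tendsto_add_atTop_iff_nat 1).2 hu.2)
  refine squeeze_zero (fun n => nnorm_nonneg _ _ _ _) (fun n => ?_) h1
  exact (hα.nnorm_sub_le _ _ _).trans
    (add_le_add (hα.nnorm_Tmap_succ_le u n) le_rfl)

/-- The solution `u` of `Gmap A u = v`. -/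
def Gsolve (A : ℕ → E →L[ℝ] E) (v : ℕ → E) : ℕ → E
  | 0 => -v 0
  | n + 1 => A n (Gsolve A v n) - v (n + 1)

theorem Gmap_Gsolve (A : ℕ → E →L[ℝ] E) (v : ℕ → E) : Gmap A (Gsolve A v) = v := by
  ext n
  cases n <;> simp [Gmap, Tmap, Gsolve]

theorem IsAdmissible.gInvertible {A : ℕ → E →L[ℝ] E} {ν : ℝ} (hν : IsAdmissible A ν)
    (h0 : ν < 0) : GInvertible A ν := by
  have hq : Real.exp ν < 1 := by simpa using h0
  refine ⟨fun u => hν.memC00_Gmap, fun v hv => ⟨Gsolve A v, ⟨by simp [Gsolve, hv.1], ?_⟩,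
    Gmap_Gsolve A v⟩, fun u _ h => Gmap_injective A (h.trans ?_), (1 - Real.exp ν)⁻¹,
    inv_pos.2 (by linarith), fun u hu => ?_⟩
  · refine tendsto_zero_of_succ_le_mul_add (fun n => nnorm_nonneg _ _ _ _) (Real.exp_pos ν).le hq
      hv.2 fun n => ?_
    exact (hν.nnorm_sub_le _ _ _).trans (add_le_add (hν.nnorm_succ_apply_le _ _) le_rfl)
  · ext n
    cases n <;> simp [Gmap, Tmap]
  · have hG := hν.memC00_Gmap hu
    have key : cnorm A ν u ≤ Real.exp ν * cnorm A ν u + cnorm A ν (Gmap A u) := by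
      refine ciSup_le fun n => ?_
      cases n with
      | zero =>
        have h1 := hu.nnorm_le_cnorm 0
        have h2 := hG.nnorm_le_cnorm 0
        have h3 := nnorm_nonneg A ν 0 (u 0)
        have h4 := nnorm_nonneg A ν 0 (Gmap A u 0)
        rw [hu.1, nnorm_zero]
        exact add_nonneg (mul_nonneg (Real.exp_pos ν).le (h3.trans h1)) (h4.trans h2)
      | succ n =>
        have h1 : u (n + 1) = Tmap A u (n + 1) - Gmap A u (n + 1) := by simp [Gmap]
        rw [h1]
        refine (hν.nnorm_sub_le _ _ _).trans (add_le_add ?_ (hG.nnorm_le_cnorm _))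
        refine (hν.nnorm_Tmap_succ_le u n).trans ?_
        gcongr
        exact hu.nnorm_le_cnorm n
    rw [inv_mul_eq_div, le_div_iff₀ (by linarith)]
    linarith

/-- The orbit of `x` started at time `n`, extended by zero to earlier times. -/
def orbit (A : ℕ → E →L[ℝ] E) (n : ℕ) (x : E) (k : ℕ) : E :=
  if n ≤ k then evol A n k x else 0

theorem orbit_self (A : ℕ → E →L[ℝ] E) (n : ℕ) (x : E) : orbit A n x n = x := by
  simp [orbit, evol_self]

theorem orbit_of_lt (A : ℕ → E →L[ℝ] E) {n k : ℕ} (x : E) (h : k < n) : orbit A n x k = 0 := by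
  simp [orbit, h]

theorem apply_orbit (A : ℕ → E →L[ℝ] E) {n k : ℕ} (x : E) (h : n ≤ k) :
    A k (orbit A n x k) = orbit A n x (k + 1) := by
  simp [orbit, h, evol_succ A h, show n ≤ k + 1 by omega]

theorem GInvertible.memC00_orbit {A : ℕ → E →L[ℝ] E} {α : ℝ} (hG : GInvertible A α) {n : ℕ}
    (hn : 1 ≤ n) (x : E) : MemC00 A α (orbit A n x) := by
  have h0 : orbit A n x 0 = 0 := orbit_of_lt A x hn
  obtain ⟨u, hu, hGu⟩ := hG.2.1 (Gmap A (orbit A n x)) <| by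
    refine memC00_of_eventually_zero (by simp [Gmap, Tmap, h0]) (N := n + 1) fun k hk => ?_
    obtain ⟨k, rfl⟩ := Nat.exists_eq_add_of_le' (show 1 ≤ k by omega)
    simp [Gmap, Tmap, apply_orbit A x (show n ≤ k by omega)]
  rwa [← Gmap_injective A hGu]

/-- If `G_α` is bounded below on `c00(α)`, the evolution contracts geometrically in the norms
`‖·‖_{n,α}`, starting from any time `n ≥ 1`. -/
theorem GInvertible.pow_mul_nnorm_evol_le {A : ℕ → E →L[ℝ] E} {α c l : ℝ}
    (hG : GInvertible A α) (hc0 : 0 < c)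
    (hc : ∀ u, MemC00 A α u → cnorm A α u ≤ c * cnorm A α (Gmap A u))
    (hl : 1 ≤ l) (hcl : c * (1 - l⁻¹) ≤ 1 / 2) {n N : ℕ} (hn : 1 ≤ n) (hN : n ≤ N) (x : E) :
    l ^ (N - n) * nnorm A α N (evol A n N x) ≤ 2 * c * nnorm A α n x := by
  have hl0 : 0 < l := by linarith
  have hd : 0 ≤ 1 - l⁻¹ := sub_nonneg.2 (inv_le_one_of_one_le₀ hl)
  set u : ℕ → E := fun k => l ^ (min k N - n) • orbit A n x k with hu_def
  have hn0 : ∀ k, nnorm A α k (u k) = l ^ (min k N - n) * nnorm A α k (orbit A n x k) := by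
    intro k
    rw [hu_def, nnorm_smul, abs_of_nonneg (by positivity)]
  have hu : MemC00 A α u := by
    have ho := hG.memC00_orbit hn x
    refine ⟨by simp [hu_def, ho.1], ?_⟩
    refine squeeze_zero (fun k => nnorm_nonneg _ _ _ _) (fun k => ?_)
      (by simpa using ho.2.const_mul (l ^ N))
    rw [hn0]
    exact mul_le_mul_of_nonneg_right (pow_le_pow_right₀ hl (by omega)) (nnorm_nonneg _ _ _ _)
  have hU : 0 ≤ cnorm A α u := (nnorm_nonneg A α 0 (u 0)).trans (hu.nnorm_le_cnorm 0)
  have hX := nnorm_nonneg A α n x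
  have hGu : cnorm A α (Gmap A u) ≤ nnorm A α n x + (1 - l⁻¹) * cnorm A α u := by
    have hR : 0 ≤ nnorm A α n x + (1 - l⁻¹) * cnorm A α u := by positivity
    refine ciSup_le fun k => ?_
    rcases k with _ | k
    · simpa [Gmap, Tmap, hu.1] using hR
    have hGk : Gmap A u (k + 1) = l ^ (min k N - n) • A k (orbit A n x k) -
        l ^ (min (k + 1) N - n) • orbit A n x (k + 1) := by
      simp [Gmap, Tmap, hu_def]
    rcases lt_or_ge k n with hkn | hkn
    · rw [hGk, orbit_of_lt A x hkn, map_zero, smul_zero, zero_sub, nnorm_neg]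
      rcases lt_or_eq_of_le (Nat.succ_le_of_lt hkn) with h | h
      · simpa [orbit_of_lt A x h] using hR
      · obtain rfl : k + 1 = n := h
        rw [orbit_self, show min (k + 1) N - (k + 1) = 0 by omega, pow_zero, one_smul]
        exact le_add_of_nonneg_right (mul_nonneg hd hU)
    · rw [apply_orbit A x hkn] at hGk
      rcases lt_or_ge k N with hkN | hkN
      · have hw : l ^ (min (k + 1) N - n) = l ^ (min k N - n) * l := by
          rw [← pow_succ]
          congr 1
          omega
        have h1 : Gmap A u (k + 1) = (-(1 - l⁻¹)) • u (k + 1) := by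
          rw [hGk]
          simp only [hu_def]
          rw [hw, smul_smul, ← sub_smul]
          congr 1
          field_simp
          ring
        rw [h1, nnorm_smul, abs_neg, abs_of_nonneg hd]
        exact (mul_le_mul_of_nonneg_left (hu.nnorm_le_cnorm _) hd).trans
          (le_add_of_nonneg_left hX)
      · rw [hGk, show min (k + 1) N = min k N by omega, sub_self, nnorm_zero]
        exact hR
  have h1 : l ^ (N - n) * nnorm A α N (evol A n N x) ≤ cnorm A α u := by
    have := hu.nnorm_le_cnorm N
    rw [hn0] at this
    simpa [orbit, hN] using this
  have h2 := (hc u hu).trans (mul_le_mul_of_nonneg_left hGu hc0.le)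
  have h3 := mul_le_mul_of_nonneg_right hcl hU
  linarith

/-- Admissibility only needs to be checked from the initial times `n ≥ 1`. -/
theorem isAdmissible_of_one_le {A : ℕ → E →L[ℝ] E} {ν : ℝ} {M : ℕ → ℝ} (hM0 : ∀ n, 0 < M n)
    (hM : ∀ m n : ℕ, 1 ≤ n → n ≤ m →
      ‖evol A n m‖ ≤ M n * Real.exp (ν * ((m : ℝ) - (n : ℝ)))) : IsAdmissible A ν := by
  refine ⟨fun n => if n = 0 then 1 + M 1 * Real.exp (-ν) * ‖A 0‖ else M n, fun n => ?_,
    fun m n h => ?_⟩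
  · have := hM0 1
    have := hM0 n
    dsimp only
    split_ifs <;> positivity
  · have hM1 := hM0 1
    dsimp only
    rcases Nat.eq_zero_or_pos n with rfl | hn
    · rw [if_pos rfl, add_mul]
      rcases Nat.eq_zero_or_pos m with rfl | hm
      · have h1 : ‖evol A 0 0‖ ≤ 1 := by
          rw [evol_self]
          exact ContinuousLinearMap.norm_id_le
        have h2 : 0 ≤ M 1 * Real.exp (-ν) * ‖A 0‖ := by positivity
        simp only [sub_self, mul_zero, Real.exp_zero, mul_one]
        linarith
      · have h1 : ‖evol A 0 m‖ ≤ ‖evol A 1 m‖ * ‖A 0‖ := by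
          rw [evol_eq_evol_succ_mul A (show 0 + 1 ≤ m from hm)]
          exact norm_mul_le _ _
        have h2 := mul_le_mul_of_nonneg_right (hM m 1 le_rfl hm) (norm_nonneg (A 0))
        have h3 : Real.exp (ν * ((m : ℝ) - ((1 : ℕ) : ℝ))) =
            Real.exp (-ν) * Real.exp (ν * ((m : ℝ) - ((0 : ℕ) : ℝ))) := by
          rw [← Real.exp_add]
          congr 1
          push_cast
          ring
        rw [h3] at h2
        have h4 := Real.exp_pos (ν * ((m : ℝ) - ((0 : ℕ) : ℝ)))
        linarith
    · rw [if_neg hn.ne']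
      exact hM m n hn h

theorem GInvertible.exists_neg_isAdmissible {A : ℕ → E →L[ℝ] E} {α : ℝ} (hG : GInvertible A α)
    (hα : IsAdmissible A α) : ∃ ν : ℝ, ν < 0 ∧ IsAdmissible A ν := by
  obtain ⟨c, hc0, hc⟩ := hG.2.2.2
  obtain ⟨M, hM0, hM⟩ := id hα
  set d : ℝ := (2 * (c + 1))⁻¹ with hd
  have hd0 : 0 < d := by positivity
  have hd1 : d < 1 := inv_lt_one_of_one_lt₀ (by linarith)
  have hcd : c * d ≤ 1 / 2 := by
    rw [hd, ← div_eq_mul_inv, div_le_div_iff₀ (by positivity) (by norm_num)]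
    linarith
  have hl : 1 ≤ (1 - d)⁻¹ := (one_le_inv₀ (by linarith)).2 (by linarith)
  have hcl : c * (1 - ((1 - d)⁻¹)⁻¹) ≤ 1 / 2 := by
    rw [inv_inv]
    linarith
  refine ⟨Real.log (1 - d), Real.log_neg (by linarith) (by linarith),
    isAdmissible_of_one_le (M := fun n => 2 * c * M n) (fun n => ?_) fun m n hn h => ?_⟩
  · have := hM0 n
    positivity
  · have hexp : Real.exp (Real.log (1 - d) * ((m : ℝ) - (n : ℝ))) = (1 - d) ^ (m - n) := by
      rw [← Nat.cast_sub h, mul_comm, Real.exp_nat_mul, Real.exp_log (by linarith)]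
    have hMn := hM0 n
    have hpow : 0 < (1 - d) ^ (m - n) := pow_pos (by linarith) _
    rw [hexp]
    refine ContinuousLinearMap.opNorm_le_bound _ (by positivity) fun x => ?_
    have h1 := hG.pow_mul_nnorm_evol_le hc0 hc hl hcl hn h x
    rw [inv_pow, inv_mul_eq_div, div_le_iff₀ hpow] at h1
    calc ‖evol A n m x‖ ≤ nnorm A α m (evol A n m x) := hα.norm_le_nnorm m _
      _ ≤ 2 * c * nnorm A α n x * (1 - d) ^ (m - n) := h1
      _ ≤ 2 * c * (M n * ‖x‖) * (1 - d) ^ (m - n) := by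
        gcongr
        exact nnorm_le_mul_norm hM n x
      _ = 2 * c * M n * (1 - d) ^ (m - n) * ‖x‖ := by ring

/-- `A` is nonuniform exponentially stable iff there is an admissible
exponent `α` for which `G_α` is invertible on `c00(α)`. -/
theorem stmt3 (A : ℕ → E →L[ℝ] E) (hA : ∃ α : ℝ, IsAdmissible A α) :
    (∃ ν : ℝ, ν < 0 ∧ IsAdmissible A ν) ↔
      (∃ α : ℝ, IsAdmissible A α ∧ GInvertible A α) := by
  constructor
  · rintro ⟨ν, hν0, hν⟩
    exact ⟨ν, hν, hν.gInvertible hν0⟩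
  · rintro ⟨α, hα, hG⟩
    exact hG.exists_neg_isAdmissible hα
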